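/- Let α₃, α₄ ∈ ℤ[√2] be coprime with α₃ > 0, and let C₁ > 0. There exist constants 0 < c₁ < c₂ and s₀ > 0 such that for all s ≥ s₀, all z₂' ∈ (0, d(s)) where d(s) = θ̂^{−1/2}λ^{−2r}s^{1/2}, all w ∈ 𝒲' and all (x₁,x₂) ∈ B(α₃,α₄): the matrix h = h(x₁,x₂,y₁,y₂,θ₁,θ₂) with y₁ > 0, θ₁ determined by y₁⁻¹(sin θ₁, cos θ₁) = (d(s), d(s) − z₂') and y₂ > 0, θ₂ determined by y₂⁻¹(sin θ₂, cos θ₂) = λ^{2r}w satisfies c₁ s^{−1/4} ≤ ‖vh‖ ≤ c₂ s^{−1/4} for each v ∈ {v₁, v₂, b₁, b₂}, where ‖·‖ is the Euclidean norm on ℝ⁴. -/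

import Mathlib

open MeasureTheory Matrix Set Pointwise

noncomputable section

/-- The real embedding of `ℤ[√2]`, `a + b√2 ↦ a + b√2`. -/
def emb (α : Zsqrtd 2) : ℝ := (α.re : ℝ) + (α.im : ℝ) * Real.sqrt 2

/-- The Galois-conjugate embedding `σ`, `a + b√2 ↦ a − b√2`. -/
def embc (α : Zsqrtd 2) : ℝ := (α.re : ℝ) - (α.im : ℝ) * Real.sqrt 2

/-- The fundamental unit `λ = 1 + √2`. -/
def lam : ℝ := 1 + Real.sqrt 2

/-- `𝓛'`: the Minkowski embedding of `ℤ[√2]` in `ℝ²`. -/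
def Lp : Set (ℝ × ℝ) := {p | ∃ α : Zsqrtd 2, p = (emb α, embc α)}

/-- `v(β₁,β₂) = (β₁, β₂, σ(β₁), σ(β₂))`. -/
def latvec (β₁ β₂ : Zsqrtd 2) : Fin 4 → ℝ := ![emb β₁, emb β₂, embc β₁, embc β₂]

/-- `𝓛`: the Minkowski embedding of `ℤ[√2]²` in `ℝ⁴`. -/
def Lquad : Set (Fin 4 → ℝ) := {v | ∃ β₁ β₂ : Zsqrtd 2, v = latvec β₁ β₂}

/-- `𝓛h`, for a 4×4 real matrix `h` (row vectors, right multiplication). -/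
def latimage (h : Matrix (Fin 4) (Fin 4) ℝ) : Set (Fin 4 → ℝ) :=
  (fun v => Matrix.vecMul v h) '' Lquad

def nmat (x : ℝ) : Matrix (Fin 2) (Fin 2) ℝ := !![1, x; 0, 1]
def amat (y : ℝ) : Matrix (Fin 2) (Fin 2) ℝ := !![y, 0; 0, y⁻¹]
def kmat (θ : ℝ) : Matrix (Fin 2) (Fin 2) ℝ :=
  !![Real.cos θ, -Real.sin θ; Real.sin θ, Real.cos θ]

/-- Block diagonal 4×4 matrix from two 2×2 blocks. -/
def bd (A B : Matrix (Fin 2) (Fin 2) ℝ) : Matrix (Fin 4) (Fin 4) ℝ :=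
  !![A 0 0, A 0 1, 0, 0;
     A 1 0, A 1 1, 0, 0;
     0, 0, B 0 0, B 0 1;
     0, 0, B 1 0, B 1 1]

/-- `h(x₁,x₂,y₁,y₂,θ₁,θ₂) = diag(n(x₁)a(y₁)k(θ₁), n(x₂)a(y₂)k(θ₂))`. -/
def hmat (x₁ x₂ y₁ y₂ θ₁ θ₂ : ℝ) : Matrix (Fin 4) (Fin 4) ℝ :=
  bd (nmat x₁ * amat y₁ * kmat θ₁) (nmat x₂ * amat y₂ * kmat θ₂)

/-- `H = SL₂(ℝ)² ⊂ SL₄(ℝ)` (block diagonal). -/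
def Hset : Set (Matrix (Fin 4) (Fin 4) ℝ) :=
  {h | ∃ A B : Matrix (Fin 2) (Fin 2) ℝ, A.det = 1 ∧ B.det = 1 ∧ h = bd A B}

/-- `Γ_K = {diag(A, σ(A)) : A ∈ SL₂(ℤ[√2])}`. -/
def GammaK : Set (Matrix (Fin 4) (Fin 4) ℝ) :=
  {g | ∃ A : Matrix (Fin 2) (Fin 2) (Zsqrtd 2), A.det = 1 ∧ g = bd (A.map emb) (A.map embc)}

/-- `𝒲`: the open regular octagon of side length √2. -/
def Woct : Set (ℝ × ℝ) :=
  {p | |p.1| < lam / Real.sqrt 2 ∧ |p.2| < lam / Real.sqrt 2 ∧ |p.1| + |p.2| < lam}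

/-- `𝒲' = 𝒲 ∖ (√2−1)𝒲`. -/
def Wp : Set (ℝ × ℝ) := Woct \ ((Real.sqrt 2 - 1) • Woct)

/-- `θ̂ = 48√2/π⁴`, the density of visible points. -/
def thetaHat : ℝ := 48 * Real.sqrt 2 / Real.pi ^ 4

/-- `T(s)`: open triangle with vertices `(0,0)`, `(s/θ̂)^{1/2}(1,±1)`. -/
def Tset (s : ℝ) : Set (ℝ × ℝ) :=
  {p | 0 < p.1 ∧ p.1 < Real.sqrt (s / thetaHat) ∧ |p.2| < p.1}

/-- `𝔉`: a fundamental domain of `𝓛'`. -/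
def Fdom : Set (ℝ × ℝ) :=
  {p | ∃ r₁ ∈ Set.Ico (0:ℝ) 1, ∃ r₂ ∈ Set.Ico (0:ℝ) 1,
    p = (1 + r₁ + r₂ * Real.sqrt 2, 2 + r₁ - r₂ * Real.sqrt 2)}

/-- The Siegel domain `𝔇_t`. -/
def Dset (t : ℝ) : Set (Matrix (Fin 4) (Fin 4) ℝ) :=
  {h | ∃ x₁ x₂ y₁ y₂ θ₁ θ₂ : ℝ, (x₁, x₂) ∈ Fdom ∧ 0 < y₁ ∧ 0 < y₂ ∧ t ≤ y₁ * y₂ ∧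
    lam ^ (-2 : ℤ) ≤ y₁ / y₂ ∧ y₁ / y₂ ≤ lam ^ 2 ∧
    θ₁ ∈ Set.Ico 0 Real.pi ∧ θ₂ ∈ Set.Ico 0 Real.pi ∧ h = hmat x₁ x₂ y₁ y₂ θ₁ θ₂}

/-- Row vector times 2×2 matrix, on `ℝ × ℝ`. -/
def mul2 (p : ℝ × ℝ) (M : Matrix (Fin 2) (Fin 2) ℝ) : ℝ × ℝ :=
  (p.1 * M 0 0 + p.2 * M 1 0, p.1 * M 0 1 + p.2 * M 1 1)

/-- `r(s)`: the unique integer with `λ^{2r} ≤ s^{1/4} < λ^{2(r+1)}`. -/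
def rr (s : ℝ) : ℤ := ⌊Real.logb (lam ^ 2) (s ^ ((1:ℝ)/4))⌋

/-- `𝒯(s)` with explicit integer `r`: `λ^{−2r}T(s) × λ^{2r}𝒲`. -/
def calT (s : ℝ) (r : ℤ) : Set (Fin 4 → ℝ) :=
  {v | (lam ^ (2*r) * v 0, lam ^ (2*r) * v 1) ∈ Tset s ∧
       (lam ^ (-(2*r)) * v 2, lam ^ (-(2*r)) * v 3) ∈ Woct}

/-- `𝒯(s) = λ^{−2r(s)}T(s) × λ^{2r(s)}𝒲`. -/
def calTs (s : ℝ) : Set (Fin 4 → ℝ) := calT s (rr s)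

/-- Euclidean norm on `ℝ⁴`. -/
def enorm4 (v : Fin 4 → ℝ) : ℝ := Real.sqrt (∑ i, (v i) ^ 2)

/-- `𝓛h̃ = (ℤ(y₁,0,y₂,0) + ℤ√2(y₁,0,−y₂,0) + ℝ(0,1,0,0) + ℝ(0,0,0,1))·diag(k(θ₁),k(θ₂))`. -/
def Ltilde (y₁ y₂ θ₁ θ₂ : ℝ) : Set (Fin 4 → ℝ) :=
  {v | ∃ (m n : ℤ) (c₁ c₂ : ℝ),
    v = Matrix.vecMul ![((m:ℝ) + (n:ℝ) * Real.sqrt 2) * y₁, c₁,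
          ((m:ℝ) - (n:ℝ) * Real.sqrt 2) * y₂, c₂] (bd (kmat θ₁) (kmat θ₂))}

open Classical in
/-- Real-valued indicator of a proposition. -/
def ind (P : Prop) : ℝ := if P then 1 else 0

/-- `c_H = 3/π⁴`. -/
def cH : ℝ := 3 / Real.pi ^ 4

/-- `Y_t = {(y₁,y₂) : y₁,y₂ > 0, y₁y₂ ≥ t, y₁/y₂ ∈ (λ⁻²,λ²)}`. -/
def Yt (t : ℝ) : Set (ℝ × ℝ) :=
  {y | 0 < y.1 ∧ 0 < y.2 ∧ t ≤ y.1 * y.2 ∧ lam ^ (-2:ℤ) < y.1 / y.2 ∧ y.1 / y.2 < lam ^ 2}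

/-- The main term `G_M(s)` (depending on the Siegel-domain parameter `t`). -/
def GM (t s : ℝ) : ℝ :=
  cH * ∫ θ₂ in Set.Ico (0:ℝ) Real.pi, ∫ θ₁ in Set.Ico (0:ℝ) Real.pi, ∫ y in Yt t, ∫ x in Fdom,
    (y.1 ^ 3 * y.2 ^ 3)⁻¹ * ind (Ltilde y.1 y.2 θ₁ θ₂ ∩ calTs s = ∅)

/-- The error term `G_E(s)`. -/
def GE (t s : ℝ) : ℝ :=
  cH * ∫ θ₂ in Set.Ico (0:ℝ) Real.pi, ∫ θ₁ in Set.Ico (0:ℝ) Real.pi, ∫ y in Yt t, ∫ x in Fdom,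
    (y.1 ^ 3 * y.2 ^ 3)⁻¹ *
      ind (latimage (hmat x.1 x.2 y.1 y.2 θ₁ θ₂) ∩ calTs s = ∅ ∧
           (Ltilde y.1 y.2 θ₁ θ₂ ∩ calTs s).Nonempty)

/-- `J = [0,π/4] ∪ [3π/4,π)`. -/
def Jset : Set ℝ := Set.Icc 0 (Real.pi/4) ∪ Set.Ico (3*Real.pi/4) Real.pi

/-- `Y = {(y₁,y₂) : y₁ > 0, 1 < y₂ < λ²}`. -/
def Yset : Set (ℝ × ℝ) := {y | 0 < y.1 ∧ 1 < y.2 ∧ y.2 < lam ^ 2}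

/-- `T₁`: open triangle with vertices `(0,0)`, `(1,±1)`. -/
def T1 : Set (ℝ × ℝ) := {p | 0 < p.1 ∧ p.1 < 1 ∧ |p.2| < p.1}

/-- `ℓ₁(θ₁)`: first-coordinate projection of `θ̂^{−1/2}T₁k(−θ₁)`. -/
def ell1 (θ₁ : ℝ) : Set ℝ :=
  {x | ∃ p ∈ T1, x = (mul2 ((Real.sqrt thetaHat)⁻¹ • p) (kmat (-θ₁))).1}

/-- `ℓ₂(θ₂)`: first-coordinate projection of `𝒲k(−θ₂)`. -/
def ell2 (θ₂ : ℝ) : Set ℝ := {x | ∃ p ∈ Woct, x = (mul2 p (kmat (-θ₂))).1}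

/-- `C_𝒫 = 2304(2−√2)/π⁸`. -/
def CP : ℝ := 2304 * (2 - Real.sqrt 2) / Real.pi ^ 8

/-- `ζ_K(2) = π⁴/(48√2)`. -/
def zetaK2 : ℝ := Real.pi ^ 4 / (48 * Real.sqrt 2)

/-- `𝒯'(s) = T(s) × 𝒲`. -/
def Tprime (s : ℝ) : Set (Fin 4 → ℝ) :=
  {v | (v 0, v 1) ∈ Tset s ∧ (v 2, v 3) ∈ Woct}

/-- `L₁(θ₁)` from Lemma 3.4: projection of `λ^{−2r}T(s)k(−θ₁)` onto the x-axis. -/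
def L1set (s : ℝ) (r : ℤ) (θ₁ : ℝ) : Set ℝ :=
  {x | ∃ p ∈ Tset s, x = (mul2 ((lam ^ (-(2*r)) : ℝ) • p) (kmat (-θ₁))).1}

/-- `L₂(θ₂)`: projection of `λ^{2r}𝒲k(−θ₂)` onto the x-axis. -/
def L2set (r : ℤ) (θ₂ : ℝ) : Set ℝ :=
  {x | ∃ p ∈ Woct, x = (mul2 ((lam ^ (2*r) : ℝ) • p) (kmat (-θ₂))).1}

/-- `n(x)a(y)k(θ)` where `y,θ` are determined by `y⁻¹(sin θ, cos θ) = z`. -/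
def hz (z : ℝ × ℝ) (x : ℝ) : Matrix (Fin 2) (Fin 2) ℝ :=
  nmat x * amat (Real.sqrt (z.1 ^ 2 + z.2 ^ 2))⁻¹ *
    !![(Real.sqrt (z.1 ^ 2 + z.2 ^ 2))⁻¹ * z.2, -((Real.sqrt (z.1 ^ 2 + z.2 ^ 2))⁻¹ * z.1);
       (Real.sqrt (z.1 ^ 2 + z.2 ^ 2))⁻¹ * z.1, (Real.sqrt (z.1 ^ 2 + z.2 ^ 2))⁻¹ * z.2]

/-- The function `F₂` of Lemma 4.7. -/
def F2 (z₁ : ℝ) : ℝ :=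
  (24 / Real.pi ^ 4) * ∫ z₂ in Set.Ioo (-z₁) z₁, ∫ w in Wp, ∫ x in Fdom,
    ind (latimage (bd (hz (z₁, z₂) x.1) (hz w x.2)) ∩ Tprime (z₁ ^ 2 * thetaHat) = ∅)

/-- The box `B(α₃,α₄)`. -/
def Bbox (α₃ α₄ : Zsqrtd 2) (C₁ s : ℝ) : Set (ℝ × ℝ) :=
  {x | |x.1 + emb α₄ / emb α₃| ≤ C₁ / Real.sqrt s ∧
       |x.2 + embc α₄ / embc α₃| ≤ C₁ / Real.sqrt s}

/-- The matrix `h` determined by `s, z₂, w, x₁, x₂` via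
`y₁⁻¹(sin θ₁, cos θ₁) = λ^{−2r}(θ̂^{−1/2}s^{1/2}, z₂)`, `y₂⁻¹(sin θ₂, cos θ₂) = λ^{2r}w`. -/
def hfull (s z₂ : ℝ) (w : ℝ × ℝ) (x₁ x₂ : ℝ) : Matrix (Fin 4) (Fin 4) ℝ :=
  bd (hz ((lam ^ (-(2 * rr s)) : ℝ) • (Real.sqrt (s / thetaHat), z₂)) x₁)
     (hz ((lam ^ (2 * rr s) : ℝ) • w) x₂)

/-- `F⁺_{(α₃,α₄)}(s)`. -/
def Fplus (α₃ α₄ : Zsqrtd 2) (C₁ s : ℝ) : ℝ :=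
  (Real.sqrt s)⁻¹ * ∫ z₂ in Set.Ioo (0:ℝ) (Real.sqrt (s / thetaHat)), ∫ w in Wp,
    ∫ x in Bbox α₃ α₄ C₁ s, ind (latimage (hfull s z₂ w x.1 x.2) ∩ calTs s = ∅)

/-- `F⁻_{(α₃,α₄)}(s)`. -/
def Fminus (α₃ α₄ : Zsqrtd 2) (C₁ s : ℝ) : ℝ :=
  (Real.sqrt s)⁻¹ * ∫ z₂ in Set.Ioo (-Real.sqrt (s / thetaHat)) (0:ℝ), ∫ w in Wp,
    ∫ x in Bbox α₃ α₄ C₁ s, ind (latimage (hfull s z₂ w x.1 x.2) ∩ calTs s = ∅)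

/-- `F_{(α₃,α₄)}(s)`. -/
def Ffull (α₃ α₄ : Zsqrtd 2) (C₁ s : ℝ) : ℝ :=
  (Real.sqrt s)⁻¹ *
    ∫ z₂ in Set.Ioo (-Real.sqrt (s / thetaHat)) (Real.sqrt (s / thetaHat)), ∫ w in Wp,
      ∫ x in Bbox α₃ α₄ C₁ s, ind (latimage (hfull s z₂ w x.1 x.2) ∩ calTs s = ∅)

/-- `v₁ = (α₃, α₄, σ(α₃), σ(α₄))`. -/
def vv1 (α₃ α₄ : Zsqrtd 2) : Fin 4 → ℝ := ![emb α₃, emb α₄, embc α₃, embc α₄]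

/-- `v₂ = (√2α₃, √2α₄, −√2σ(α₃), −√2σ(α₄))`. -/
def vv2 (α₃ α₄ : Zsqrtd 2) : Fin 4 → ℝ :=
  ![Real.sqrt 2 * emb α₃, Real.sqrt 2 * emb α₄,
    -(Real.sqrt 2 * embc α₃), -(Real.sqrt 2 * embc α₄)]

/-- `b₁ = (α₃, α₄, 0, 0)`. -/
def bb1 (α₃ α₄ : Zsqrtd 2) : Fin 4 → ℝ := ![emb α₃, emb α₄, 0, 0]

/-- `b₂ = (0, 0, σ(α₃), σ(α₄))`. -/
def bb2 (α₃ α₄ : Zsqrtd 2) : Fin 4 → ℝ := ![0, 0, embc α₃, embc α₄]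

/-- The subgrid `𝓛_v = v + ℤv₁ + ℤv₂`. -/
def Lv (α₃ α₄ : Zsqrtd 2) (v : Fin 4 → ℝ) : Set (Fin 4 → ℝ) :=
  {u | ∃ m n : ℤ, u = v + (m:ℝ) • vv1 α₃ α₄ + (n:ℝ) • vv2 α₃ α₄}

/-- The filled plane `Π_v = v + ℝb₁ + ℝb₂`. -/
def Piv (α₃ α₄ : Zsqrtd 2) (v : Fin 4 → ℝ) : Set (Fin 4 → ℝ) :=
  {u | ∃ c₁ c₂ : ℝ, u = v + c₁ • bb1 α₃ α₄ + c₂ • bb2 α₃ α₄}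

/-- `d(s) = θ̂^{−1/2}λ^{−2r}s^{1/2}`. -/
def ds (s : ℝ) : ℝ := lam ^ (-(2 * rr s)) * Real.sqrt (s / thetaHat)

/-- The explicit integral representation `Φ(s)` of the limiting gap distribution `F(s)`. -/
def Phi (s : ℝ) : ℝ :=
  (1 / ((2:ℝ) ^ ((11:ℝ)/2) * Real.sqrt thetaHat * zetaK2 * Real.sqrt s)) *
    ∫ z₂ in Set.Ioo (-Real.sqrt (s / thetaHat)) (Real.sqrt (s / thetaHat)), ∫ w in Wp,
      ∫ x in Fdom, ind (latimage (hfull s z₂ w x.1 x.2) ∩ calTs s = ∅)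


theorem sq_add_sq_mul_hz (z : ℝ × ℝ) (hz0 : 0 < z.1 ^ 2 + z.2 ^ 2) (x a b : ℝ) :
    (a * hz z x 0 0 + b * hz z x 1 0) ^ 2 + (a * hz z x 0 1 + b * hz z x 1 1) ^ 2
      = a ^ 2 / (z.1 ^ 2 + z.2 ^ 2) + (a * x + b) ^ 2 * (z.1 ^ 2 + z.2 ^ 2) := by
  have hR : 0 < Real.sqrt (z.1 ^ 2 + z.2 ^ 2) := Real.sqrt_pos.2 hz0
  have hq : Real.sqrt (z.1 ^ 2 + z.2 ^ 2) ^ 2 = z.1 ^ 2 + z.2 ^ 2 := Real.sq_sqrt hz0.le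
  simp only [hz, nmat, amat, Matrix.mul_apply, Fin.sum_univ_two, Matrix.of_apply,
    Matrix.cons_val', Matrix.cons_val_zero, Matrix.cons_val_one, Matrix.cons_val_fin_one,
    inv_inv]
  set R := Real.sqrt (z.1 ^ 2 + z.2 ^ 2)
  have hunit : (z.1 / R) ^ 2 + (z.2 / R) ^ 2 = 1 := by
    rw [div_pow, div_pow, hq, ← add_div, div_self hz0.ne']
  rw [← hq]
  calc _ = (a ^ 2 / R ^ 2 + (a * x + b) ^ 2 * R ^ 2) * ((z.1 / R) ^ 2 + (z.2 / R) ^ 2) := by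
        field_simp
        ring
    _ = _ := by rw [hunit, mul_one]

theorem enorm4_vecMul_bd_hz (k₁ k₂ a b a' b' x x' : ℝ) (z z' : ℝ × ℝ)
    (hz0 : 0 < z.1 ^ 2 + z.2 ^ 2) (hz0' : 0 < z'.1 ^ 2 + z'.2 ^ 2) :
    enorm4 (Matrix.vecMul ![k₁ * a, k₁ * b, k₂ * a', k₂ * b'] (bd (hz z x) (hz z' x')))
      = Real.sqrt (k₁ ^ 2 * (a ^ 2 / (z.1 ^ 2 + z.2 ^ 2) + (a * x + b) ^ 2 * (z.1 ^ 2 + z.2 ^ 2))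
        + k₂ ^ 2 * (a' ^ 2 / (z'.1 ^ 2 + z'.2 ^ 2)
          + (a' * x' + b') ^ 2 * (z'.1 ^ 2 + z'.2 ^ 2))) := by
  rw [← sq_add_sq_mul_hz z hz0, ← sq_add_sq_mul_hz z' hz0', enorm4]
  congr 1
  simp [Fin.sum_univ_four, Matrix.vecMul, dotProduct, bd]
  ring

/-- Two-sided bound for the squared norm of one block, when `q ≍ t²`. -/
theorem block_bounds {a b x C t m M q : ℝ} (ha : a ≠ 0) (hx : |x + b / a| ≤ C / t ^ 2)
    (ht : 0 < t) (hm : 0 < m) (hmq : m * t ^ 2 ≤ q) (hqM : q ≤ M * t ^ 2) :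
    a ^ 2 / M / t ^ 2 ≤ a ^ 2 / q + (a * x + b) ^ 2 * q ∧
      a ^ 2 / q + (a * x + b) ^ 2 * q ≤ (a ^ 2 / m + a ^ 2 * C ^ 2 * M) / t ^ 2 := by
  have hq : 0 < q := lt_of_lt_of_le (by positivity) hmq
  have hab : (a * x + b) ^ 2 ≤ a ^ 2 * (C / t ^ 2) ^ 2 := by
    have h1 : a * x + b = a * (x + b / a) := by field_simp
    rw [h1, mul_pow]
    exact mul_le_mul_of_nonneg_left (sq_le_sq' (abs_le.1 hx).1 (abs_le.1 hx).2) (sq_nonneg a)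
  constructor
  · have h1 : a ^ 2 / M / t ^ 2 ≤ a ^ 2 / q := by
      rw [div_div]
      gcongr
    have h2 : 0 ≤ (a * x + b) ^ 2 * q := by positivity
    linarith
  · have h1 : a ^ 2 / q ≤ a ^ 2 / (m * t ^ 2) := by gcongr
    have h2 : (a * x + b) ^ 2 * q ≤ a ^ 2 * (C / t ^ 2) ^ 2 * (M * t ^ 2) := by gcongr
    calc _ ≤ a ^ 2 / (m * t ^ 2) + a ^ 2 * (C / t ^ 2) ^ 2 * (M * t ^ 2) := add_le_add h1 h2
      _ = _ := by field_simp

theorem one_lt_lam : 1 < lam := by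
  have : 0 < Real.sqrt 2 := by positivity
  unfold lam
  linarith

theorem lam_zpow_rr {s : ℝ} (hs : 0 < s) :
    lam ^ (2 * rr s) ≤ s ^ ((1:ℝ)/4) ∧ s ^ ((1:ℝ)/4) < lam ^ 2 * lam ^ (2 * rr s) := by
  have hl := one_lt_lam
  have hl2 : 1 < lam ^ 2 := one_lt_pow₀ hl two_ne_zero
  have ht : 0 < s ^ ((1:ℝ)/4) := Real.rpow_pos_of_pos hs _
  have hz : lam ^ (2 * rr s) = (lam ^ 2) ^ ((rr s : ℤ) : ℝ) := by
    rw [Real.rpow_intCast, _root_.zpow_mul]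
    norm_cast
  constructor
  · rw [hz, ← Real.le_logb_iff_rpow_le hl2 ht]
    exact Int.floor_le _
  · have h1 : lam ^ 2 * lam ^ (2 * rr s) = (lam ^ 2) ^ ((rr s : ℝ) + 1) := by
      rw [hz, Real.rpow_add_one (by positivity)]
      ring
    rw [h1, ← Real.logb_lt_iff_lt_rpow hl2 ht]
    exact Int.lt_floor_add_one _

theorem Wp_sq_bounds {w : ℝ × ℝ} (hw : w ∈ Wp) :
    1 / 4 ≤ w.1 ^ 2 + w.2 ^ 2 ∧ w.1 ^ 2 + w.2 ^ 2 ≤ lam ^ 2 := by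
  obtain ⟨⟨-, -, hw3⟩, hn⟩ := hw
  have h2 : Real.sqrt 2 ^ 2 = 2 := Real.sq_sqrt (by norm_num)
  have hl := one_lt_lam
  have hp1 := abs_nonneg w.1
  have hp2 := abs_nonneg w.2
  rw [← sq_abs w.1, ← sq_abs w.2]
  refine ⟨?_, by nlinarith⟩
  by_contra! hlt
  have h1 : |w.1| < 1 / 2 := by nlinarith
  have h1' : |w.2| < 1 / 2 := by nlinarith
  apply hn
  have hs2 : 1 / 2 ≤ 1 / Real.sqrt 2 := by
    have : Real.sqrt 2 ≤ 2 := by nlinarith [Real.sqrt_nonneg 2]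
    gcongr
  refine Set.mem_smul_set.2 ⟨lam • w, ⟨?_, ?_, ?_⟩, ?_⟩
  · simp only [Prod.smul_fst, smul_eq_mul, abs_mul, abs_of_pos (by linarith : 0 < lam)]
    rw [div_eq_mul_one_div]
    gcongr
    linarith
  · simp only [Prod.smul_snd, smul_eq_mul, abs_mul, abs_of_pos (by linarith : 0 < lam)]
    rw [div_eq_mul_one_div]
    gcongr
    linarith
  · simp only [Prod.smul_fst, Prod.smul_snd, smul_eq_mul, abs_mul,
      abs_of_pos (by linarith : 0 < lam)]
    nlinarith
  · have : (Real.sqrt 2 - 1) * lam = 1 := by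
      unfold lam
      linear_combination h2
    rw [smul_smul, this, one_smul]

theorem embc_ne_zero {α : Zsqrtd 2} (hα : emb α ≠ 0) : embc α ≠ 0 := by
  intro h
  unfold embc at h
  by_cases him : α.im = 0
  · apply hα
    simpa [him, emb] using h
  · refine irrational_sqrt_two ⟨(α.re : ℚ) / α.im, ?_⟩
    have : (α.im : ℝ) ≠ 0 := by exact_mod_cast him
    push_cast
    rw [div_eq_iff this]
    linarith

theorem thetaHat_pos : 0 < thetaHat := by
  unfold thetaHat
  positivity

theorem sqrt_eq_rpow_sq {s : ℝ} (hs : 0 ≤ s) : Real.sqrt s = (s ^ ((1:ℝ)/4)) ^ 2 := by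
  rw [← Real.rpow_natCast, ← Real.rpow_mul hs, Real.sqrt_eq_rpow]
  norm_num

theorem ds_sq_bounds {s : ℝ} (hs : 0 < s) :
    1 / thetaHat * (s ^ ((1:ℝ)/4)) ^ 2 ≤ ds s ^ 2 ∧
      ds s ^ 2 ≤ lam ^ 4 / thetaHat * (s ^ ((1:ℝ)/4)) ^ 2 := by
  have hθ := thetaHat_pos
  have hl0 : 0 < lam := by linarith [one_lt_lam]
  have hst := sqrt_eq_rpow_sq hs.le
  obtain ⟨hr1, hr2⟩ := lam_zpow_rr hs
  have ht0 : 0 < s ^ ((1:ℝ)/4) := Real.rpow_pos_of_pos hs _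
  set t := s ^ ((1:ℝ)/4)
  have hds : ds s ^ 2 = t ^ 4 / thetaHat / (lam ^ (2 * rr s)) ^ 2 := by
    rw [ds, _root_.zpow_neg, Real.sqrt_div hs.le, hst, mul_pow, div_pow, Real.sq_sqrt hθ.le]
    field_simp
  have hP0 : 0 < lam ^ (2 * rr s) := zpow_pos hl0 _
  set P := lam ^ (2 * rr s)
  rw [hds, le_div_iff₀ (by positivity), div_le_iff₀ (by positivity)]
  constructor
  · calc 1 / thetaHat * t ^ 2 * P ^ 2 ≤ 1 / thetaHat * t ^ 2 * t ^ 2 := by gcongr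
      _ = _ := by ring
  · calc t ^ 4 / thetaHat = t ^ 2 / thetaHat * t ^ 2 := by ring
      _ ≤ t ^ 2 / thetaHat * (lam ^ 2 * P) ^ 2 := by gcongr
      _ = _ := by ring

theorem sqrt_weighted_bounds {k₁ k₂ N N' A A' U U' t : ℝ} (ht : 0 < t)
    (hk : 1 ≤ k₁ ^ 2 + k₂ ^ 2) (hk₁ : k₁ ^ 2 ≤ 2) (hk₂ : k₂ ^ 2 ≤ 2) (hA : 0 < min A A')
    (hAN : A / t ^ 2 ≤ N) (hAN' : A' / t ^ 2 ≤ N') (hNU : N ≤ U / t ^ 2)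
    (hNU' : N' ≤ U' / t ^ 2) :
    Real.sqrt (min A A') * t⁻¹ ≤ Real.sqrt (k₁ ^ 2 * N + k₂ ^ 2 * N') ∧
      Real.sqrt (k₁ ^ 2 * N + k₂ ^ 2 * N') ≤
        (Real.sqrt (min A A') + Real.sqrt (2 * (U + U'))) * t⁻¹ := by
  have hroot : ∀ B : ℝ, Real.sqrt (B / t ^ 2) = Real.sqrt B * t⁻¹ := fun B => by
    rw [Real.sqrt_div' _ (by positivity), Real.sqrt_sq ht.le, div_eq_mul_inv]
  have hm1 : min A A' / t ^ 2 ≤ N := le_trans (by gcongr; exact min_le_left _ _) hAN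
  have hm2 : min A A' / t ^ 2 ≤ N' := le_trans (by gcongr; exact min_le_right _ _) hAN'
  have hm0 : 0 ≤ min A A' / t ^ 2 := div_nonneg hA.le (sq_nonneg t)
  constructor
  · rw [← hroot]
    apply Real.sqrt_le_sqrt
    calc min A A' / t ^ 2 ≤ (k₁ ^ 2 + k₂ ^ 2) * (min A A' / t ^ 2) :=
          le_mul_of_one_le_left hm0 hk
      _ = k₁ ^ 2 * (min A A' / t ^ 2) + k₂ ^ 2 * (min A A' / t ^ 2) := by ring
      _ ≤ _ := by gcongr
  · rw [add_mul, ← hroot (2 * (U + U'))]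
    have hle : k₁ ^ 2 * N + k₂ ^ 2 * N' ≤ 2 * (U + U') / t ^ 2 :=
      calc k₁ ^ 2 * N + k₂ ^ 2 * N' ≤ 2 * N + 2 * N' :=
            add_le_add (mul_le_mul_of_nonneg_right hk₁ (hm0.trans hm1))
              (mul_le_mul_of_nonneg_right hk₂ (hm0.trans hm2))
        _ ≤ 2 * (U / t ^ 2) + 2 * (U' / t ^ 2) := by gcongr
        _ = _ := by ring
    exact (Real.sqrt_le_sqrt hle).trans (le_add_of_nonneg_left (by positivity))

theorem stmt17 (α₃ α₄ : Zsqrtd 2) (hcop : IsCoprime α₃ α₄) (hpos : 0 < emb α₃)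
    (C₁ : ℝ) (hC₁ : 0 < C₁) :
    ∃ c₁ c₂ s₀ : ℝ, 0 < c₁ ∧ c₁ < c₂ ∧ 0 < s₀ ∧
      ∀ s ≥ s₀, ∀ z₂' ∈ Set.Ioo (0:ℝ) (ds s), ∀ w ∈ Wp, ∀ x ∈ Bbox α₃ α₄ C₁ s,
        ∀ v ∈ ({vv1 α₃ α₄, vv2 α₃ α₄, bb1 α₃ α₄, bb2 α₃ α₄} : Set (Fin 4 → ℝ)),
          c₁ * s ^ (-(1:ℝ)/4) ≤
            enorm4 (Matrix.vecMul v
              (bd (hz (ds s, ds s - z₂') x.1) (hz ((lam ^ (2 * rr s) : ℝ) • w) x.2))) ∧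
          enorm4 (Matrix.vecMul v
              (bd (hz (ds s, ds s - z₂') x.1) (hz ((lam ^ (2 * rr s) : ℝ) • w) x.2)))
            ≤ c₂ * s ^ (-(1:ℝ)/4) := by
  have hemb := hpos.ne'
  have hembc := embc_ne_zero hemb
  have hl := one_lt_lam
  have hl0 : 0 < lam := by linarith
  have hθ := thetaHat_pos
  set a := emb α₃
  set a' := embc α₃
  set A := a ^ 2 / (2 * lam ^ 4 / thetaHat)
  set A' := a' ^ 2 / lam ^ 2
  set U := a ^ 2 / (1 / thetaHat) + a ^ 2 * C₁ ^ 2 * (2 * lam ^ 4 / thetaHat)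
  set U' := a' ^ 2 / (1 / (4 * lam ^ 4)) + a' ^ 2 * C₁ ^ 2 * lam ^ 2
  have hA0 : 0 < A := by positivity
  have hA0' : 0 < A' := by positivity
  have hU0 : 0 < U := by positivity
  have hU0' : 0 < U' := by positivity
  have hmin : 0 < min A A' := lt_min hA0 hA0'
  have hsum : 0 < Real.sqrt (2 * (U + U')) := Real.sqrt_pos.2 (by positivity)
  refine ⟨Real.sqrt (min A A'), Real.sqrt (min A A') + Real.sqrt (2 * (U + U')), 1,
    Real.sqrt_pos.2 hmin, by linarith, one_pos, ?_⟩
  intro s hs z hz' w hw x hx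
  have hs0 : 0 < s := by linarith
  obtain ⟨hr1, hr2⟩ := lam_zpow_rr hs0
  set t := s ^ ((1:ℝ)/4) with ht
  have ht0 : 0 < t := Real.rpow_pos_of_pos hs0 _
  have hst := sqrt_eq_rpow_sq hs0.le
  rw [← ht] at hst
  have hneg : s ^ (-(1:ℝ)/4) = t⁻¹ := by
    rw [ht, ← Real.rpow_neg hs0.le]
    norm_num
  set P := lam ^ (2 * rr s)
  have hP0 : 0 < P := zpow_pos hl0 _
  obtain ⟨hds1, hds2⟩ := ds_sq_bounds hs0
  rw [← ht] at hds1 hds2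
  obtain ⟨hw1, hw2⟩ := Wp_sq_bounds hw
  have hq1 : 1 / thetaHat * t ^ 2 ≤ ds s ^ 2 + (ds s - z) ^ 2 := by
    nlinarith [sq_nonneg (ds s - z)]
  have hq2 : ds s ^ 2 + (ds s - z) ^ 2 ≤ 2 * lam ^ 4 / thetaHat * t ^ 2 := by
    have : (ds s - z) ^ 2 ≤ ds s ^ 2 := by nlinarith [hz'.1, hz'.2]
    calc _ ≤ 2 * (lam ^ 4 / thetaHat * t ^ 2) := by linarith
      _ = _ := by ring
  have hqw : (P • w).1 ^ 2 + (P • w).2 ^ 2 = P ^ 2 * (w.1 ^ 2 + w.2 ^ 2) := by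
    simp only [Prod.smul_fst, Prod.smul_snd, smul_eq_mul]
    ring
  have hq1' : 1 / (4 * lam ^ 4) * t ^ 2 ≤ (P • w).1 ^ 2 + (P • w).2 ^ 2 := by
    rw [hqw]
    calc 1 / (4 * lam ^ 4) * t ^ 2 ≤ 1 / (4 * lam ^ 4) * (lam ^ 2 * P) ^ 2 := by gcongr
      _ = P ^ 2 * (1 / 4) := by field_simp
      _ ≤ _ := by gcongr
  have hq2' : (P • w).1 ^ 2 + (P • w).2 ^ 2 ≤ lam ^ 2 * t ^ 2 := by
    rw [hqw, mul_comm]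
    gcongr
  obtain ⟨hx1, hx2⟩ := hx
  rw [hst] at hx1 hx2
  obtain ⟨hN1, hN2⟩ := block_bounds hemb hx1 ht0 (by positivity) hq1 hq2
  obtain ⟨hN1', hN2'⟩ := block_bounds hembc hx2 ht0 (by positivity) hq1' hq2'
  have key : ∀ k₁ k₂ : ℝ, 1 ≤ k₁ ^ 2 + k₂ ^ 2 → k₁ ^ 2 ≤ 2 → k₂ ^ 2 ≤ 2 →
      ∀ v, v = ![k₁ * a, k₁ * emb α₄, k₂ * a', k₂ * embc α₄] →
      Real.sqrt (min A A') * t⁻¹ ≤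
        enorm4 (Matrix.vecMul v (bd (hz (ds s, ds s - z) x.1) (hz (P • w) x.2))) ∧
      enorm4 (Matrix.vecMul v (bd (hz (ds s, ds s - z) x.1) (hz (P • w) x.2)))
        ≤ (Real.sqrt (min A A') + Real.sqrt (2 * (U + U'))) * t⁻¹ := by
    rintro k₁ k₂ h1 hk₁ hk₂ v rfl
    rw [enorm4_vecMul_bd_hz k₁ k₂ _ _ _ _ _ _ _ _ (lt_of_lt_of_le (by positivity) hq1)
      (lt_of_lt_of_le (by positivity) hq1')]
    exact sqrt_weighted_bounds ht0 h1 hk₁ hk₂ hmin hN1 hN1' hN2 hN2'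
  have h2 : Real.sqrt 2 ^ 2 = 2 := Real.sq_sqrt (by norm_num)
  intro v hv
  rw [hneg]
  simp only [Set.mem_insert_iff, Set.mem_singleton_iff] at hv
  rcases hv with rfl | rfl | rfl | rfl
  · exact key 1 1 (by norm_num) (by norm_num) (by norm_num) _ (by simp [vv1, a, a'])
  · exact key (Real.sqrt 2) (-Real.sqrt 2) (by rw [neg_sq, h2]; norm_num) h2.le
      (by rw [neg_sq, h2]) _ (by simp [vv2, a, a'])
  · exact key 1 0 (by norm_num) (by norm_num) (by norm_num) _ (by simp [bb1, a])
  · exact key 0 1 (by norm_num) (by norm_num) (by norm_num) _ (by simp [bb2, a'])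

end
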